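/- For every real x > 0, the box limit defining F(1,1,1,x) exists and F(1,1,1,x)/(3+x)² = Σ_{n∈ℤ} Σ_{k=0}^∞ (−1)^{n+k}(2k+1)/(3(2k+1)² + x(6n+1)²)², where the double sum on the right is absolutely convergent. -/

import Mathlib

open Real Filter Topology

/-- The partial "box" sum appearing in the definition of the lattice sum `F(a,b,c,d)`. -/
noncomputable def boxSum (a b c d : ℝ) (v : ℕ) : ℝ :=
  ∑ n₁ ∈ Finset.Icc (-(v:ℤ)) (v:ℤ), ∑ n₂ ∈ Finset.Icc (-(v:ℤ)) (v:ℤ),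
    ∑ n₃ ∈ Finset.Icc (-(v:ℤ)) (v:ℤ), ∑ n₄ ∈ Finset.Icc (-(v:ℤ)) (v:ℤ),
      (-1:ℝ)^(n₁+n₂+n₃+n₄) /
        (a*((6*n₁+1:ℤ):ℝ)^2 + b*((6*n₂+1:ℤ):ℝ)^2 + c*((6*n₃+1:ℤ):ℝ)^2 + d*((6*n₄+1:ℤ):ℝ)^2)^2

/-- The finite `q`-Pochhammer symbol `(q; q)_n = ∏_{i=1}^n (1 - q^i)`. -/
noncomputable def qPoch (q : ℝ) (n : ℕ) : ℝ := ∏ i ∈ Finset.range n, (1 - q ^ (i + 1))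

/-- The Gaussian binomial coefficient, defined by the `q`-Pascal rule. -/
noncomputable def gaussBinom (q : ℝ) : ℕ → ℕ → ℝ
  | _, 0 => 1
  | 0, _ + 1 => 0
  | n + 1, k + 1 => gaussBinom q n k + q ^ (k + 1) * gaussBinom q n (k + 1)

theorem qPoch_succ (q : ℝ) (n : ℕ) : qPoch q (n + 1) = qPoch q n * (1 - q ^ (n + 1)) :=
  Finset.prod_range_succ _ _

theorem gaussBinom_eq_zero (q : ℝ) {n k : ℕ} (h : n < k) : gaussBinom q n k = 0 := by
  induction n generalizing k with
  | zero => obtain ⟨k, rfl⟩ := Nat.exists_eq_add_of_lt h; simp [gaussBinom]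
  | succ n ih =>
    obtain _ | k := k
    · omega
    · rw [gaussBinom, ih (by omega), ih (by omega)]; simp

theorem gaussBinom_self (q : ℝ) (n : ℕ) : gaussBinom q n n = 1 := by
  induction n with
  | zero => simp [gaussBinom]
  | succ n ih => rw [gaussBinom, ih, gaussBinom_eq_zero q (by omega)]; simp

theorem gaussBinom_mul_qPoch (q : ℝ) (a b : ℕ) :
    gaussBinom q (a + b) a * (qPoch q a * qPoch q b) = qPoch q (a + b) := by
  induction a generalizing b with
  | zero => simp [gaussBinom, qPoch]
  | succ a iha =>
    induction b with
    | zero => simp [gaussBinom_self, qPoch]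
    | succ b ihb =>
      have h1 := iha (b + 1)
      rw [show a + 1 + (b + 1) = (a + (b + 1)) + 1 by ring, gaussBinom, qPoch_succ q (a + (b + 1)),
        ← h1]
      rw [show a + 1 + b = a + (b + 1) by ring] at ihb
      have h2 := ihb.trans h1.symm
      rw [qPoch_succ q b] at *
      rw [qPoch_succ q a] at *
      linear_combination (1 - q ^ (b + 1)) * q ^ (a + 1) * h2

/-- The `q`-binomial theorem. -/
theorem prod_add_mul_pow (q y z : ℝ) (N : ℕ) :
    ∏ i ∈ Finset.range N, (y + z * q ^ i) =
      ∑ k ∈ Finset.range (N + 1), q ^ (k.choose 2) * gaussBinom q N k * z ^ k * y ^ (N - k) := by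
  induction N generalizing z with
  | zero => simp [gaussBinom]
  | succ N ih =>
    rw [Finset.prod_range_succ']
    have h : ∀ i, y + z * q ^ (i + 1) = y + (z * q) * q ^ i := fun i => by ring
    simp_rw [h]
    rw [ih, Finset.sum_range_succ' _ (N + 1)]
    have e : ∀ k ∈ Finset.range (N + 1), q ^ ((k + 1).choose 2) * gaussBinom q (N + 1) (k + 1) *
        z ^ (k + 1) * y ^ (N + 1 - (k + 1)) =
        z * (q ^ (k.choose 2) * gaussBinom q N k * (z * q) ^ k * y ^ (N - k)) +
        q ^ ((k + 1).choose 2) * gaussBinom q N (k + 1) * (z * q) ^ (k + 1) * y ^ (N - k) := by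
      intro k _
      rw [Nat.succ_sub_succ, gaussBinom, Nat.choose_succ_succ' k 1, Nat.choose_one_right]
      ring
    rw [Finset.sum_congr rfl e, Finset.sum_add_distrib, ← Finset.mul_sum]
    have e2 : ∑ k ∈ Finset.range (N + 1), q ^ ((k + 1).choose 2) * gaussBinom q N (k + 1) *
        (z * q) ^ (k + 1) * y ^ (N - k) + q ^ (Nat.choose 0 2) * gaussBinom q (N + 1) 0 * z ^ 0
          * y ^ (N + 1 - 0) =
        y * ∑ k ∈ Finset.range (N + 1), q ^ (k.choose 2) * gaussBinom q N k * (z * q) ^ k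
          * y ^ (N - k) := by
      rw [Finset.sum_range_succ, gaussBinom_eq_zero q (by omega : N < N + 1),
        Finset.sum_range_succ' _ N, mul_add, Finset.mul_sum]
      simp only [gaussBinom, mul_zero, zero_mul, add_zero]
      congr 1
      · refine Finset.sum_congr rfl fun k hk => ?_
        rw [show N - k = (N - (k + 1)) + 1 by grind]
        ring
      · simp [pow_succ']
    rw [add_assoc, e2]
    ring

theorem two_mul_choose_two (n : ℕ) : 2 * ((n.choose 2 : ℕ) : ℤ) = n * (n - 1) := by
  induction n with
  | zero => simp
  | succ n ih =>
    rw [Nat.choose_succ_succ' n 1, Nat.choose_one_right]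
    push_cast
    linarith

theorem prod_pow_sub_pow_lower (q : ℝ) (n : ℕ) :
    ∏ i ∈ Finset.range n, (q ^ n - q ^ i) = (-1) ^ n * q ^ (n.choose 2) * qPoch q n := by
  have h : ∀ i ∈ Finset.range n, q ^ n - q ^ i = (-1) * q ^ i * (1 - q ^ (n - 1 - i + 1)) := by
    intro i hi
    rw [Finset.mem_range] at hi
    have : q ^ n = q ^ i * q ^ (n - 1 - i + 1) := by rw [← pow_add]; congr 1; omega
    rw [this]; ring
  rw [Finset.prod_congr rfl h, Finset.prod_mul_distrib, Finset.prod_mul_distrib,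
    Finset.prod_range_reflect (fun i => 1 - q ^ (i + 1)), Finset.prod_pow_eq_pow_sum,
    Finset.sum_range_id, Nat.choose_two_right]
  simp [qPoch]

theorem prod_pow_sub_pow_upper (q : ℝ) (n : ℕ) :
    ∏ i ∈ Finset.range n, (q ^ n - q ^ (n + 1 + i)) = q ^ (n * n) * qPoch q n := by
  have h : ∀ i, q ^ n - q ^ (n + 1 + i) = q ^ n * (1 - q ^ (i + 1)) := by
    intro i; ring
  simp_rw [h, Finset.prod_mul_distrib]
  simp [qPoch, pow_mul]

/-- A finite form of Jacobi's identity for the cube of the Euler function. -/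
theorem finite_jacobi (q : ℝ) (h0 : 0 < q) (hp : ∀ n, qPoch q n ≠ 0) (n : ℕ) :
    ∑ j ∈ Finset.range (n + 1), (-1) ^ j * (2 * (j : ℝ) + 1) * q ^ ((j + 1).choose 2) *
      (qPoch q (2 * n + 1) / (qPoch q (n - j) * qPoch q (n + 1 + j))) = qPoch q n ^ 2 := by
  -- differentiate the `q`-binomial theorem at a simple root
  have hd1 : HasDerivAt (fun y : ℝ => ∏ i ∈ Finset.range (2 * n + 1), (y + (-1) * q ^ i))
      ((-1) ^ n * q ^ (n.choose 2) * qPoch q n * (q ^ (n * n) * qPoch q n)) (q ^ n) := by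
    have e : (fun y : ℝ => ∏ i ∈ Finset.range (2 * n + 1), (y + (-1) * q ^ i)) =
        fun y => (y - q ^ n) * ((∏ i ∈ Finset.range n, (y - q ^ i)) *
          ∏ i ∈ Finset.range n, (y - q ^ (n + 1 + i))) := by
      ext y
      rw [show 2 * n + 1 = (n + 1) + n by ring, Finset.prod_range_add, Finset.prod_range_succ]
      simp only [neg_one_mul, ← sub_eq_add_neg]
      ring
    rw [e]
    have hg : DifferentiableAt ℝ (fun y : ℝ => (∏ i ∈ Finset.range n, (y - q ^ i)) *
          ∏ i ∈ Finset.range n, (y - q ^ (n + 1 + i))) (q ^ n) := by fun_prop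
    refine (((hasDerivAt_id' (q ^ n)).sub_const (q ^ n)).fun_mul hg.hasDerivAt).congr_deriv ?_
    simp [prod_pow_sub_pow_lower, prod_pow_sub_pow_upper]
  have hd2 : HasDerivAt (fun y : ℝ => ∏ i ∈ Finset.range (2 * n + 1), (y + (-1) * q ^ i))
      (∑ k ∈ Finset.range (2 * n + 1 + 1), q ^ (k.choose 2) * gaussBinom q (2 * n + 1) k *
        (-1) ^ k * (((2 * n + 1 - k : ℕ) : ℝ) * (q ^ n) ^ (2 * n + 1 - k - 1))) (q ^ n) := by
    rw [funext fun y => prod_add_mul_pow q y (-1) (2 * n + 1)]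
    exact HasDerivAt.fun_sum fun k _ => (hasDerivAt_pow _ _).const_mul _
  have key := hd1.unique hd2
  have hgb : ∀ k ≤ 2 * n + 1, gaussBinom q (2 * n + 1) k =
      qPoch q (2 * n + 1) / (qPoch q k * qPoch q (2 * n + 1 - k)) := by
    intro k hk
    rw [eq_div_iff (mul_ne_zero (hp _) (hp _))]
    have := gaussBinom_mul_qPoch q k (2 * n + 1 - k)
    rwa [show k + (2 * n + 1 - k) = 2 * n + 1 by omega] at this
  rw [show 2 * n + 1 + 1 = (n + 1) + (n + 1) by ring, Finset.sum_range_add,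
    ← Finset.sum_range_reflect, ← Finset.sum_add_distrib] at key
  have hterm : ∀ j ∈ Finset.range (n + 1),
      q ^ ((n + 1 - 1 - j).choose 2) * gaussBinom q (2 * n + 1) (n + 1 - 1 - j) *
        (-1) ^ (n + 1 - 1 - j) * (((2 * n + 1 - (n + 1 - 1 - j) : ℕ) : ℝ) *
          (q ^ n) ^ (2 * n + 1 - (n + 1 - 1 - j) - 1)) +
      q ^ ((n + 1 + j).choose 2) * gaussBinom q (2 * n + 1) (n + 1 + j) *
        (-1) ^ (n + 1 + j) * (((2 * n + 1 - (n + 1 + j) : ℕ) : ℝ) *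
          (q ^ n) ^ (2 * n + 1 - (n + 1 + j) - 1)) =
      ((-1) ^ n * q ^ (n.choose 2) * q ^ (n * n)) *
      ((-1) ^ j * (2 * (j : ℝ) + 1) * q ^ ((j + 1).choose 2) *
      (qPoch q (2 * n + 1) / (qPoch q (n - j) * qPoch q (n + 1 + j)))) := by
    intro j hj
    obtain ⟨m, rfl⟩ : ∃ m, n = j + m := ⟨n - j, by grind⟩
    have s1 : j + m + 1 - 1 - j = m := by omega
    have s2 : 2 * (j + m) + 1 - m = 2 * j + m + 1 := by omega
    have s3 : 2 * (j + m) + 1 - (j + m + 1 + j) = m := by omega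
    have s4 : j + m - j = m := by omega
    rw [hgb _ (by omega), hgb _ (by omega), s1, s2, s3, s4,
      show j + m + 1 + j = 2 * j + m + 1 by ring, Nat.add_sub_cancel]
    rw [mul_comm (qPoch q (2 * j + m + 1)) (qPoch q m)]
    set c := qPoch q (2 * (j + m) + 1) / (qPoch q m * qPoch q (2 * j + m + 1))
    have c1 := two_mul_choose_two m
    have c2 := two_mul_choose_two (2 * j + m + 1)
    have c3 := two_mul_choose_two (j + m)
    have c4 := two_mul_choose_two (j + 1)
    push_cast at c1 c2 c3 c4
    have x1 : q ^ (m.choose 2) * (q ^ (j + m)) ^ (2 * j + m) =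
        q ^ ((j + m).choose 2) * q ^ ((j + m) * (j + m)) * q ^ ((j + 1).choose 2) := by
      rw [← pow_mul, ← pow_add, ← pow_add, ← pow_add]
      congr 1
      zify
      linarith
    have g1 : ((-1 : ℝ)) ^ (j + m) * (-1) ^ j = (-1) ^ m := by
      rw [← pow_add, show j + m + j = m + 2 * j by ring, pow_add, pow_mul]; simp
    have g2 : ((-1 : ℝ)) ^ (2 * j + m + 1) = - (-1) ^ m := by
      rw [pow_succ, pow_add, pow_mul]; simp
    have x2 : q ^ ((2 * j + m + 1).choose 2) * ((m : ℝ) * (q ^ (j + m)) ^ (m - 1)) =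
        m * (q ^ ((j + m).choose 2) * q ^ ((j + m) * (j + m)) * q ^ ((j + 1).choose 2)) := by
      rcases m with _ | m
      · simp
      · rw [Nat.add_sub_cancel, mul_left_comm, ← pow_mul, ← pow_add, ← pow_add, ← pow_add]
        congr 2
        zify
        push_cast at c1 c2 c3 c4
        linarith
    rw [g2]
    push_cast
    linear_combination c * (-1) ^ m * (2 * j + m + 1) * x1 - c * (-1) ^ m * x2
      - c * (2 * j + 1) * (q ^ ((j + m).choose 2) * q ^ ((j + m) * (j + m)) *
        q ^ ((j + 1).choose 2)) * g1
  rw [Finset.sum_congr rfl hterm, ← Finset.mul_sum] at key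
  have hne : ((-1) ^ n * q ^ (n.choose 2) * q ^ (n * n)) ≠ 0 := by
    have := h0.ne'
    simp [this]
  apply mul_left_cancel₀ hne
  rw [← key]
  ring

section Limits

variable {q : ℝ}

theorem summable_pow_add_one (h0 : 0 < q) (h1 : q < 1) (k : ℕ) :
    Summable fun n : ℕ => q ^ (n + k + 1) := by
  simp_rw [add_assoc, pow_add q]
  exact (summable_geometric_of_lt_one h0.le h1).mul_right _

theorem multipliable_one_sub_pow_add (h0 : 0 < q) (h1 : q < 1) (k : ℕ) :
    Multipliable fun n : ℕ => 1 - q ^ (n + k + 1) := by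
  simp_rw [sub_eq_add_neg]
  refine multipliable_one_add_of_summable ?_
  simpa [abs_of_pos h0] using summable_pow_add_one h0 h1 k

theorem one_sub_pow_succ_pos (h0 : 0 < q) (h1 : q < 1) (n : ℕ) : 0 < 1 - q ^ (n + 1) :=
  sub_pos.2 (pow_lt_one₀ h0.le h1 (by omega))

theorem qPoch_pos (h0 : 0 < q) (h1 : q < 1) (n : ℕ) : 0 < qPoch q n :=
  Finset.prod_pos fun i _ => one_sub_pow_succ_pos h0 h1 i

theorem qPoch_antitone (h0 : 0 < q) (h1 : q < 1) : Antitone (qPoch q) :=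
  antitone_nat_of_succ_le fun n => by
    rw [qPoch_succ]
    exact mul_le_of_le_one_right (qPoch_pos h0 h1 n).le (by linarith [pow_pos h0 (n + 1)])

theorem tendsto_qPoch (h0 : 0 < q) (h1 : q < 1) :
    Tendsto (qPoch q) atTop (𝓝 (∏' n : ℕ, (1 - q ^ (n + 1)))) :=
  (multipliable_one_sub_pow_add h0 h1 0).tendsto_prod_tprod_nat

theorem tprod_one_sub_pow_ne_zero (h0 : 0 < q) (h1 : q < 1) :
    ∏' n : ℕ, (1 - q ^ (n + 1)) ≠ 0 := by
  simp_rw [sub_eq_add_neg]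
  refine tprod_one_add_ne_zero_of_summable (fun i => ?_) ?_
  · rw [← sub_eq_add_neg]
    exact (one_sub_pow_succ_pos h0 h1 i).ne'
  · simpa [abs_of_pos h0] using summable_pow_add_one h0 h1 0

theorem tprod_one_sub_pow_le (h0 : 0 < q) (h1 : q < 1) (n : ℕ) :
    ∏' n : ℕ, (1 - q ^ (n + 1)) ≤ qPoch q n :=
  (qPoch_antitone h0 h1).le_of_tendsto (tendsto_qPoch h0 h1) n

theorem tprod_one_sub_pow_pos (h0 : 0 < q) (h1 : q < 1) :
    0 < ∏' n : ℕ, (1 - q ^ (n + 1)) :=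
  (ge_of_tendsto' (tendsto_qPoch h0 h1) fun n => (qPoch_pos h0 h1 n).le).lt_of_ne
    (tprod_one_sub_pow_ne_zero h0 h1).symm

theorem summable_two_mul_add_one_mul_pow_choose (h0 : 0 < q) (h1 : q < 1) :
    Summable fun j : ℕ => (2 * (j : ℝ) + 1) * q ^ ((j + 1).choose 2) := by
  have hs : Summable fun j : ℕ => (2 * (j : ℝ) + 1) * q ^ j := by
    have h := summable_pow_mul_geometric_of_norm_lt_one 1
      (by rwa [Real.norm_of_nonneg h0.le] : ‖q‖ < 1)
    refine ((h.mul_left 2).add (summable_geometric_of_lt_one h0.le h1)).congr fun j => ?_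
    ring
  refine hs.of_nonneg_of_le (fun j => by positivity) fun j => ?_
  refine mul_le_mul_of_nonneg_left (pow_le_pow_of_le_one h0.le h1.le ?_) (by positivity)
  rw [Nat.choose_succ_succ' j 1, Nat.choose_one_right]
  omega

/-- **Jacobi's identity** for the cube of the Euler function. -/
theorem tprod_one_sub_pow_cube (h0 : 0 < q) (h1 : q < 1) :
    (∏' n : ℕ, (1 - q ^ (n + 1))) ^ 3 =
      ∑' j : ℕ, (-1) ^ j * (2 * (j : ℝ) + 1) * q ^ ((j + 1).choose 2) := by
  have hφ := tprod_one_sub_pow_pos h0 h1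
  have hle := tprod_one_sub_pow_le h0 h1
  have hlim := tendsto_qPoch h0 h1
  set φ := ∏' n : ℕ, (1 - q ^ (n + 1)) with hφdef
  have hpos := qPoch_pos h0 h1
  let f : ℕ → ℕ → ℝ := fun n => (Finset.range (n + 1) : Set ℕ).indicator fun j =>
    (-1) ^ j * (2 * (j : ℝ) + 1) * q ^ ((j + 1).choose 2) *
      (qPoch q (2 * n + 1) / (qPoch q (n - j) * qPoch q (n + 1 + j)))
  have hf : ∀ n, ∑' j, f n j = qPoch q n ^ 2 := fun n => by
    rw [← finite_jacobi q h0 (fun n => (hpos n).ne') n]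
    exact (sum_eq_tsum_indicator _ _).symm
  have ht : Tendsto (fun n => ∑' j, f n j) atTop
      (𝓝 (∑' j : ℕ, (-1) ^ j * (2 * (j : ℝ) + 1) * q ^ ((j + 1).choose 2) * (φ / (φ * φ)))) := by
    refine tendsto_tsum_of_dominated_convergence
      ((summable_two_mul_add_one_mul_pow_choose h0 h1).mul_right (1 / φ)) (fun j => ?_)
      (Eventually.of_forall fun n j => ?_)
    · have h : Tendsto (fun n => (-1) ^ j * (2 * (j : ℝ) + 1) * q ^ ((j + 1).choose 2) *
          (qPoch q (2 * n + 1) / (qPoch q (n - j) * qPoch q (n + 1 + j)))) atTop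
          (𝓝 ((-1) ^ j * (2 * (j : ℝ) + 1) * q ^ ((j + 1).choose 2) * (φ / (φ * φ)))) := by
        refine Tendsto.const_mul _ (Tendsto.div (hlim.comp ?_) (Tendsto.mul (hlim.comp ?_)
          (hlim.comp ?_)) (by positivity))
        · exact tendsto_atTop_mono (fun n => by simp only [id]; omega) tendsto_id
        · exact tendsto_sub_atTop_nat j
        · exact tendsto_atTop_mono (fun n => by simp only [id]; omega) tendsto_id
      refine h.congr' ?_
      filter_upwards [eventually_ge_atTop j] with n hn
      simp only [f]
      rw [Set.indicator_of_mem (by simpa using Nat.lt_succ_of_le hn)]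
    · simp only [f]
      by_cases hj : j ∈ (Finset.range (n + 1) : Set ℕ)
      · rw [Set.indicator_of_mem hj]
        have hj' : j < n + 1 := by simpa using hj
        rw [norm_mul, norm_mul, norm_mul, norm_pow, norm_neg, norm_one, one_pow, one_mul,
          Real.norm_of_nonneg (by positivity : 0 ≤ 2 * (j : ℝ) + 1),
          Real.norm_of_nonneg (by positivity : 0 ≤ q ^ ((j + 1).choose 2)),
          Real.norm_of_nonneg (div_nonneg (hpos _).le (mul_pos (hpos _) (hpos _)).le)]
        refine mul_le_mul_of_nonneg_left ?_ (by positivity)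
        rw [div_le_div_iff₀ (mul_pos (hpos _) (hpos _)) hφ, one_mul, mul_comm]
        exact mul_le_mul (hle _) (qPoch_antitone h0 h1 (by omega)) (hpos _).le (hpos _).le
      · rw [Set.indicator_of_notMem hj, norm_zero]
        positivity
  simp_rw [hf] at ht
  have := tendsto_nhds_unique ht (hlim.pow 2)
  rw [tsum_mul_right] at this
  field_simp at this
  linarith

theorem summable_pow_pentagonal (h0 : 0 < q) (h1 : q < 1) :
    Summable fun k : ℕ => (-1) ^ k * (q ^ pentagonal (-k) - q ^ pentagonal (k + 1)) := by
  have hg := summable_geometric_of_lt_one h0.le h1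
  refine (hg.add hg).of_norm_bounded fun k => ?_
  rw [norm_mul, norm_pow, norm_neg, norm_one, one_pow, one_mul]
  have a1 := two_mul_natCast_pentagonal_neg k
  have a2 := two_mul_natCast_pentagonal (k + 1)
  refine (norm_sub_le _ _).trans (add_le_add ?_ ?_) <;>
  · rw [Real.norm_of_nonneg (by positivity)]
    refine pow_le_pow_of_le_one h0.le h1.le ?_
    zify
    nlinarith

/-- The **pentagonal number theorem** for real `q`. -/
theorem tprod_one_sub_pow_eq_tsum_pentagonal (h0 : 0 < q) (h1 : q < 1) :
    ∏' n : ℕ, (1 - q ^ (n + 1)) =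
      ∑' k : ℕ, (-1) ^ k * (q ^ pentagonal (-k) - q ^ pentagonal (k + 1)) := by
  have hprod0 : ∀ k n : ℕ, 0 ≤ ∏ i ∈ Finset.range (n + 1), (1 - q ^ (k + i + 1)) := fun k n =>
    Finset.prod_nonneg fun i _ => (one_sub_pow_succ_pos h0 h1 _).le
  have hprod1 : ∀ k n : ℕ, ∏ i ∈ Finset.range (n + 1), (1 - q ^ (k + i + 1)) ≤ 1 := fun k n =>
    Finset.prod_le_one (fun i _ => (one_sub_pow_succ_pos h0 h1 _).le)
      fun i _ => by linarith [pow_pos h0 (k + i + 1)]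
  have hle : ∀ k n : ℕ, q ^ ((k + 1) * n) * ∏ i ∈ Finset.range (n + 1), (1 - q ^ (k + i + 1)) ≤
      q ^ n := fun k n => by
    refine (mul_le_of_le_one_right (by positivity) (hprod1 k n)).trans
      (pow_le_pow_of_le_one h0.le h1.le ?_)
    exact Nat.le_mul_of_pos_left n (by omega)
  have hnn : ∀ k n : ℕ,
      0 ≤ q ^ ((k + 1) * n) * ∏ i ∈ Finset.range (n + 1), (1 - q ^ (k + i + 1)) :=
    fun k n => mul_nonneg (by positivity) (hprod0 k n)
  have hgeo := summable_geometric_of_lt_one h0.le h1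
  have hsum : ∀ k : ℕ, Summable fun n : ℕ =>
      q ^ ((k + 1) * n) * ∏ i ∈ Finset.range (n + 1), (1 - q ^ (k + i + 1)) := fun k =>
    hgeo.of_nonneg_of_le (hnn k) (hle k)
  have hq := tendsto_pow_atTop_nhds_zero_of_lt_one h0.le h1
  refine Pentagonal.tprod_one_sub_pow hq hsum (multipliable_one_sub_pow_add h0 h1)
    (summable_pow_pentagonal h0 h1) ?_
  refine squeeze_zero_norm (a := fun k => q ^ k * ∑' n : ℕ, q ^ n) (fun k => ?_) ?_
  · rw [norm_mul, norm_mul, norm_pow, norm_neg, norm_one, one_pow, one_mul,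
      Real.norm_of_nonneg (by positivity), Real.norm_of_nonneg (tsum_nonneg (hnn k))]
    refine mul_le_mul (pow_le_pow_of_le_one h0.le h1.le ?_)
      ((hsum k).tsum_le_tsum (hle k) hgeo) (tsum_nonneg (hnn k)) (by positivity)
    rw [Nat.le_div_iff_mul_le (by norm_num)]
    nlinarith
  · simpa using hq.mul_const (∑' n : ℕ, q ^ n)

end Limits

section Theta

/-- The general term of the theta series of `η`. -/
noncomputable def etaTerm (t : ℝ) (n : ℤ) : ℝ := (-1) ^ n * exp (-((6 * (n : ℝ) + 1) ^ 2 * t))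

theorem abs_etaTerm (t : ℝ) (n : ℤ) : |etaTerm t n| = exp (-((6 * (n : ℝ) + 1) ^ 2 * t)) := by
  rw [etaTerm, abs_mul, abs_zpow, abs_neg, abs_one, one_zpow, one_mul, abs_of_pos (exp_pos _)]

theorem six_mul_add_one_ne_zero (n : ℤ) : (6 * (n : ℝ) + 1) ≠ 0 := by
  have : (6 * n + 1 : ℤ) ≠ 0 := by omega
  exact_mod_cast this

theorem summable_etaTerm {t : ℝ} (ht : 0 < t) : Summable (etaTerm t) := by
  have hs := ((Real.summable_one_div_int_add_rpow (1 / 6) 2).2 (by norm_num)).mul_left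
    (1 / (36 * t))
  refine hs.of_norm_bounded fun n => ?_
  rw [Real.norm_eq_abs, abs_etaTerm]
  have hn : 0 < (6 * (n : ℝ) + 1) ^ 2 := by
    have := six_mul_add_one_ne_zero n
    positivity
  have e : 1 / (36 * t) * (1 / |(n : ℝ) + 1 / 6| ^ (2 : ℝ)) = 1 / ((6 * (n : ℝ) + 1) ^ 2 * t) := by
    rw [Real.rpow_two, sq_abs, div_mul_div_comm, one_mul]
    congr 1
    ring
  rw [e, exp_neg, ← one_div]
  refine one_div_le_one_div_of_le (by positivity) ?_
  linarith [add_one_le_exp ((6 * (n : ℝ) + 1) ^ 2 * t)]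

theorem exp_neg_mul_pow_eq (t : ℝ) (m : ℕ) (y : ℝ) (h : y = 1 + 24 * (m : ℝ)) :
    exp (-t) * exp (-(24 * t)) ^ m = exp (-(y * t)) := by
  rw [← Real.exp_nat_mul, ← Real.exp_add, h]
  congr 1
  ring

theorem tsum_etaTerm {t : ℝ} (ht : 0 < t) :
    ∑' n, etaTerm t n = exp (-t) * ∏' n : ℕ, (1 - exp (-(24 * t)) ^ (n + 1)) := by
  have hs := summable_etaTerm ht
  have hs1 : Summable fun n : ℕ => etaTerm t n := hs.comp_injective Nat.cast_injective
  have hs2 : Summable fun n : ℕ => etaTerm t (-(n + 1)) :=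
    hs.comp_injective fun a b h => by simpa using h
  rw [tsum_of_nat_of_neg_add_one hs1 hs2, ← hs1.tsum_add hs2,
    tprod_one_sub_pow_eq_tsum_pentagonal (exp_pos _) (by simpa using ht), ← tsum_mul_left]
  refine tsum_congr fun k => ?_
  have a1 : 2 * (pentagonal (-k) : ℝ) = k * (3 * k + 1) := by
    exact_mod_cast two_mul_natCast_pentagonal_neg k
  have a2 : 2 * (pentagonal (k + 1) : ℝ) = (k + 1) * (3 * (k + 1) - 1) := by
    exact_mod_cast two_mul_natCast_pentagonal (k + 1)
  rw [mul_left_comm, mul_sub, exp_neg_mul_pow_eq t _ ((6 * (k : ℝ) + 1) ^ 2) (by linarith),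
    exp_neg_mul_pow_eq t _ ((6 * (k : ℝ) + 5) ^ 2) (by linarith), etaTerm, etaTerm, zpow_neg,
    ← inv_zpow, zpow_natCast, inv_neg_one, zpow_add_one₀ (by norm_num), zpow_natCast]
  push_cast
  rw [show (6 * (-((k : ℝ) + 1)) + 1) ^ 2 = (6 * (k : ℝ) + 5) ^ 2 by ring]
  ring

theorem two_mul_choose_succ_two (k : ℕ) : 2 * ((k + 1).choose 2 : ℝ) = (k + 1) * k := by
  have := two_mul_choose_two (k + 1)
  push_cast at this
  rw [add_sub_cancel_right] at this
  exact_mod_cast this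

theorem tsum_etaTerm_cube {t : ℝ} (ht : 0 < t) :
    (∑' n, etaTerm t n) ^ 3 =
      ∑' k : ℕ, (-1) ^ k * (2 * (k : ℝ) + 1) * exp (-(3 * (2 * (k : ℝ) + 1) ^ 2 * t)) := by
  rw [tsum_etaTerm ht, mul_pow, tprod_one_sub_pow_cube (exp_pos _) (by simpa using ht),
    ← tsum_mul_left]
  refine tsum_congr fun k => ?_
  rw [mul_left_comm, ← Real.exp_nat_mul, ← Real.exp_nat_mul, ← Real.exp_add]
  congr 2
  push_cast
  linear_combination -12 * t * two_mul_choose_succ_two k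

theorem summable_two_mul_add_one_mul_exp {t : ℝ} (ht : 0 < t) :
    Summable fun k : ℕ =>
      (-1) ^ k * (2 * (k : ℝ) + 1) * exp (-(3 * (2 * (k : ℝ) + 1) ^ 2 * t)) := by
  have h := (summable_two_mul_add_one_mul_pow_choose (exp_pos (-(24 * t)))
    (by simpa using ht)).mul_left (exp (-(3 * t)))
  refine h.of_norm_bounded fun k => le_of_eq ?_
  rw [norm_mul, norm_mul, norm_pow, norm_neg, norm_one, one_pow, one_mul,
    Real.norm_of_nonneg (by positivity), Real.norm_of_nonneg (by positivity), mul_left_comm,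
    ← Real.exp_nat_mul, ← Real.exp_add]
  congr 2
  linear_combination 12 * t * two_mul_choose_succ_two k

/-- The symmetric partial sums of the theta series of `η`. -/
noncomputable def etaPartial (v : ℕ) (t : ℝ) : ℝ :=
  ∑ n ∈ Finset.Icc (-(v : ℤ)) (v : ℤ), etaTerm t n

theorem tendsto_etaPartial {t : ℝ} (ht : 0 < t) :
    Tendsto (fun v => etaPartial v t) atTop (𝓝 (∑' n, etaTerm t n)) :=
  (summable_etaTerm ht).hasSum.comp (Finset.tendsto_Icc_neg (R := ℤ))

theorem alternating_sum_mem_Icc (n : ℕ) (b : ℕ → ℝ) (hb : Antitone b) (h0 : ∀ i, 0 ≤ b i) :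
    ∑ i ∈ Finset.range n, (-1) ^ i * b i ∈ Set.Icc 0 (b 0) := by
  induction n generalizing b with
  | zero => simp [h0 0]
  | succ n ih =>
    have h := ih (fun i => b (i + 1)) (fun i j hij => hb (by omega)) fun i => h0 _
    rw [Finset.sum_range_succ']
    simp only [pow_succ, mul_neg_one, neg_mul, Finset.sum_neg_distrib, pow_zero, one_mul]
    have := hb (Nat.zero_le 1)
    exact ⟨by linarith [h.2], by linarith [h.1]⟩

theorem etaPartial_eq (v : ℕ) (t : ℝ) :
    etaPartial v t = exp (-t) - ∑ i ∈ Finset.range v, (-1) ^ i *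
      (exp (-((6 * (i : ℝ) + 5) ^ 2 * t)) + exp (-((6 * (i : ℝ) + 7) ^ 2 * t))) := by
  induction v with
  | zero => simp [etaPartial, etaTerm]
  | succ v ih =>
    have hI : Finset.Icc (-((v + 1 : ℕ) : ℤ)) ((v + 1 : ℕ) : ℤ) =
        insert (-((v : ℤ) + 1)) (insert ((v : ℤ) + 1) (Finset.Icc (-(v : ℤ)) (v : ℤ))) := by
      ext n
      simp only [Finset.mem_Icc, Finset.mem_insert]
      omega
    rw [etaPartial, hI, Finset.sum_insert (by simp; omega), Finset.sum_insert (by simp),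
      ← etaPartial, ih, Finset.sum_range_succ, etaTerm, etaTerm, zpow_neg,
      ← inv_zpow, inv_neg_one, zpow_add_one₀ (by norm_num), zpow_natCast]
    push_cast
    rw [show (6 * (-((v : ℝ) + 1)) + 1) ^ 2 = (6 * (v : ℝ) + 5) ^ 2 by ring,
      show (6 * (((v : ℝ) + 1)) + 1) ^ 2 = (6 * (v : ℝ) + 7) ^ 2 by ring]
    ring

theorem abs_etaPartial_le (v : ℕ) {t : ℝ} (ht : 0 < t) : |etaPartial v t| ≤ exp (-t) := by
  have h := alternating_sum_mem_Icc v
    (fun i : ℕ => exp (-((6 * (i : ℝ) + 5) ^ 2 * t)) + exp (-((6 * (i : ℝ) + 7) ^ 2 * t)))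
    (fun i j hij => by
      have : (i : ℝ) ≤ j := by exact_mod_cast hij
      dsimp only
      gcongr) (fun i => by positivity)
  rw [etaPartial_eq, abs_le]
  have h5 : exp (-((6 * ((0 : ℕ) : ℝ) + 5) ^ 2 * t)) ≤ exp (-t) :=
    exp_le_exp.2 (by push_cast; linarith)
  have h7 : exp (-((6 * ((0 : ℕ) : ℝ) + 7) ^ 2 * t)) ≤ exp (-t) :=
    exp_le_exp.2 (by push_cast; linarith)
  exact ⟨by linarith [h.2], by linarith [h.1]⟩

theorem continuous_etaPartial (v : ℕ) : Continuous (etaPartial v) := by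
  unfold etaPartial etaTerm
  fun_prop

end Theta

section Integral

open MeasureTheory Set

theorem integral_mul_exp_neg_mul {A : ℝ} (hA : 0 < A) :
    ∫ t in Ioi (0 : ℝ), t * exp (-(A * t)) = 1 / A ^ 2 := by
  have h := Real.integral_rpow_mul_exp_neg_mul_Ioi (a := 2) (by norm_num) hA
  norm_num at h
  rw [h, one_div]

theorem integrableOn_mul_exp_neg_mul {A : ℝ} (hA : 0 < A) :
    IntegrableOn (fun t : ℝ => t * exp (-(A * t))) (Ioi 0) := by
  refine not_imp_comm.1 integral_undef ?_
  rw [integral_mul_exp_neg_mul hA]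
  positivity

theorem six_mul_add_one_sq_pos (n : ℤ) : 0 < (6 * (n : ℝ) + 1) ^ 2 := by
  have := six_mul_add_one_ne_zero n
  positivity

theorem boxSum_eq_integral {x : ℝ} (hx : 0 < x) (v : ℕ) :
    boxSum 1 1 1 x v =
      ∫ t in Ioi (0 : ℝ), t * (etaPartial v t ^ 3 * etaPartial v (x * t)) := by
  set s := Finset.Icc (-(v : ℤ)) (v : ℤ) with hs
  let A : ℤ → ℤ → ℤ → ℤ → ℝ := fun n₁ n₂ n₃ n₄ =>
    1 * ((6 * n₁ + 1 : ℤ) : ℝ) ^ 2 + 1 * ((6 * n₂ + 1 : ℤ) : ℝ) ^ 2 +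
      1 * ((6 * n₃ + 1 : ℤ) : ℝ) ^ 2 + x * ((6 * n₄ + 1 : ℤ) : ℝ) ^ 2
  have hA : ∀ n₁ n₂ n₃ n₄, 0 < A n₁ n₂ n₃ n₄ := fun n₁ n₂ n₃ n₄ => by
    have h1 := six_mul_add_one_sq_pos n₁
    have h2 := six_mul_add_one_sq_pos n₂
    have h3 := six_mul_add_one_sq_pos n₃
    have h4 := six_mul_add_one_sq_pos n₄
    simp only [A]
    push_cast
    positivity
  have h_integrable : ∀ n₁ n₂ n₃ n₄ : ℤ, Integrable
      (fun t : ℝ => (-1 : ℝ) ^ (n₁ + n₂ + n₃ + n₄) * (t * exp (-(A n₁ n₂ n₃ n₄ * t))))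
      (volume.restrict (Ioi 0)) := fun n₁ n₂ n₃ n₄ =>
    (integrableOn_mul_exp_neg_mul (hA n₁ n₂ n₃ n₄)).const_mul _
  have hexp : ∀ t : ℝ, t * (etaPartial v t ^ 3 * etaPartial v (x * t)) =
      ∑ n₁ ∈ s, ∑ n₂ ∈ s, ∑ n₃ ∈ s, ∑ n₄ ∈ s,
        (-1 : ℝ) ^ (n₁ + n₂ + n₃ + n₄) * (t * exp (-(A n₁ n₂ n₃ n₄ * t))) := fun t => by
    have hterm : ∀ n₁ n₂ n₃ n₄ : ℤ,
        (-1 : ℝ) ^ (n₁ + n₂ + n₃ + n₄) * (t * exp (-(A n₁ n₂ n₃ n₄ * t))) =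
        t * (etaTerm t n₁ * (etaTerm t n₂ * (etaTerm t n₃ * etaTerm (x * t) n₄))) := by
      intro n₁ n₂ n₃ n₄
      have e : exp (-(A n₁ n₂ n₃ n₄ * t)) = exp (-((6 * (n₁ : ℝ) + 1) ^ 2 * t)) *
          exp (-((6 * (n₂ : ℝ) + 1) ^ 2 * t)) * exp (-((6 * (n₃ : ℝ) + 1) ^ 2 * t)) *
          exp (-((6 * (n₄ : ℝ) + 1) ^ 2 * (x * t))) := by
        rw [← Real.exp_add, ← Real.exp_add, ← Real.exp_add]
        congr 1
        simp only [A]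
        push_cast
        ring
      rw [e, zpow_add₀ (by norm_num), zpow_add₀ (by norm_num), zpow_add₀ (by norm_num)]
      simp only [etaTerm]
      ring
    simp_rw [hterm, ← Finset.mul_sum, ← Finset.sum_mul]
    simp only [etaPartial, ← hs]
    ring
  simp_rw [hexp]
  rw [integral_finsetSum _ fun n₁ _ => integrable_finsetSum _ fun n₂ _ =>
    integrable_finsetSum _ fun n₃ _ => integrable_finsetSum _ fun n₄ _ => h_integrable n₁ n₂ n₃ n₄]
  refine Finset.sum_congr rfl fun n₁ _ => ?_
  rw [integral_finsetSum _ fun n₂ _ => integrable_finsetSum _ fun n₃ _ =>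
    integrable_finsetSum _ fun n₄ _ => h_integrable n₁ n₂ n₃ n₄]
  refine Finset.sum_congr rfl fun n₂ _ => ?_
  rw [integral_finsetSum _ fun n₃ _ => integrable_finsetSum _ fun n₄ _ => h_integrable n₁ n₂ n₃ n₄]
  refine Finset.sum_congr rfl fun n₃ _ => ?_
  rw [integral_finsetSum _ fun n₄ _ => h_integrable n₁ n₂ n₃ n₄]
  refine Finset.sum_congr rfl fun n₄ _ => ?_
  rw [integral_const_mul, integral_mul_exp_neg_mul (hA n₁ n₂ n₃ n₄), mul_one_div]

theorem tendsto_boxSum {x : ℝ} (hx : 0 < x) :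
    Tendsto (fun v => boxSum 1 1 1 x v) atTop
      (𝓝 (∫ t in Ioi (0 : ℝ), t * ((∑' n, etaTerm t n) ^ 3 * ∑' n, etaTerm (x * t) n))) := by
  simp_rw [boxSum_eq_integral hx]
  refine tendsto_integral_of_dominated_convergence (fun t => t * exp (-((3 + x) * t)))
    (fun v => ?_) (integrableOn_mul_exp_neg_mul (by positivity)) (fun v => ?_) ?_
  · have := continuous_etaPartial v
    exact Continuous.aestronglyMeasurable (by fun_prop)
  · filter_upwards [ae_restrict_mem measurableSet_Ioi] with t ht
    have ht : 0 < t := ht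
    rw [norm_mul, norm_mul, norm_pow, Real.norm_of_nonneg ht.le, Real.norm_eq_abs,
      Real.norm_eq_abs]
    have e : exp (-((3 + x) * t)) = exp (-t) ^ 3 * exp (-(x * t)) := by
      rw [← Real.exp_nat_mul, ← Real.exp_add]
      congr 1
      push_cast
      ring
    rw [e]
    gcongr
    · exact abs_etaPartial_le v ht
    · exact abs_etaPartial_le v (mul_pos hx ht)
  · filter_upwards [ae_restrict_mem measurableSet_Ioi] with t ht
    exact (((tendsto_etaPartial ht).pow 3).mul (tendsto_etaPartial (mul_pos hx ht))).const_mul t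

theorem summable_two_mul_add_one_div {x : ℝ} (hx : 0 < x) :
    Summable fun p : ℤ × ℕ => (2 * (p.2 : ℝ) + 1) /
      (3 * (2 * (p.2 : ℝ) + 1) ^ 2 + x * (6 * (p.1 : ℝ) + 1) ^ 2) ^ 2 := by
  have s1 := (Real.summable_one_div_int_add_rpow (1 / 6) (3 / 2)).2 (by norm_num)
  have s2 := (Real.summable_one_div_nat_add_rpow (1 / 2) (3 / 2)).2 (by norm_num)
  have s := (s1.mul_of_nonneg s2 (fun n => by positivity) (fun n => by positivity)).mul_left
    (2 / (12 ^ (5 / 4 : ℝ) * (36 * x) ^ (3 / 4 : ℝ)))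
  refine s.of_nonneg_of_le (fun p => by positivity) fun p => ?_
  obtain ⟨n, k⟩ := p
  set a := |(n : ℝ) + 1 / 6| with ha
  set b := |(k : ℝ) + 1 / 2| with hb
  have hb0 : b = k + 1 / 2 := abs_of_pos (by positivity)
  have ha0 : 0 < a := abs_pos.2 fun h => six_mul_add_one_ne_zero n (by linarith)
  have hbpos : 0 < b := by rw [hb0]; positivity
  have e1 : 2 * (k : ℝ) + 1 = 2 * b := by rw [hb0]; ring
  have e2 : (6 * (n : ℝ) + 1) ^ 2 = 36 * a ^ 2 := by rw [ha, sq_abs]; ring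
  simp only [e1, e2]
  have key : (12 * b ^ 2) ^ (5 / 4 : ℝ) * (36 * x * a ^ 2) ^ (3 / 4 : ℝ) ≤
      (3 * (2 * b) ^ 2 + x * (36 * a ^ 2)) ^ 2 := by
    have e : (3 * (2 * b) ^ 2 + x * (36 * a ^ 2)) ^ 2 =
        (3 * (2 * b) ^ 2 + x * (36 * a ^ 2)) ^ (5 / 4 : ℝ) *
        (3 * (2 * b) ^ 2 + x * (36 * a ^ 2)) ^ (3 / 4 : ℝ) := by
      rw [← Real.rpow_add (by positivity), ← Real.rpow_natCast]
      norm_num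
    rw [e]
    gcongr
    · nlinarith [mul_pos hx (pow_pos ha0 2)]
    · nlinarith [pow_pos hbpos 2]
  have e3 : (12 * b ^ 2) ^ (5 / 4 : ℝ) = 12 ^ (5 / 4 : ℝ) * (b * b ^ (3 / 2 : ℝ)) := by
    rw [Real.mul_rpow (by norm_num) (by positivity), ← Real.rpow_natCast b 2,
      ← Real.rpow_mul hbpos.le, ← Real.rpow_one_add' hbpos.le (by norm_num)]
    norm_num
  have e4 : (36 * x * a ^ 2) ^ (3 / 4 : ℝ) = (36 * x) ^ (3 / 4 : ℝ) * a ^ (3 / 2 : ℝ) := by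
    rw [Real.mul_rpow (by positivity) (by positivity), ← Real.rpow_natCast a 2,
      ← Real.rpow_mul ha0.le]
    norm_num
  rw [e3, e4] at key
  refine (div_le_div_of_nonneg_left (by positivity) (by positivity) key).trans (le_of_eq ?_)
  field_simp

theorem hasSum_integral_etaTerm {x : ℝ} (hx : 0 < x) :
    HasSum (fun p : ℤ × ℕ => (-1 : ℝ) ^ (p.1 + (p.2 : ℤ)) * (2 * (p.2 : ℝ) + 1) /
        (3 * (2 * (p.2 : ℝ) + 1) ^ 2 + x * (6 * (p.1 : ℝ) + 1) ^ 2) ^ 2)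
      (∫ t in Ioi (0 : ℝ), t * ((∑' n, etaTerm t n) ^ 3 * ∑' n, etaTerm (x * t) n)) := by
  let A : ℤ × ℕ → ℝ := fun p => 3 * (2 * (p.2 : ℝ) + 1) ^ 2 + x * (6 * (p.1 : ℝ) + 1) ^ 2
  have hA : ∀ p, 0 < A p := fun p => by positivity
  let F : ℤ × ℕ → ℝ → ℝ := fun p t =>
    ((-1 : ℝ) ^ (p.1 + (p.2 : ℤ)) * (2 * (p.2 : ℝ) + 1)) * (t * exp (-(A p * t)))
  have hF : ∀ p, Integrable (F p) (volume.restrict (Ioi 0)) := fun p =>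
    (integrableOn_mul_exp_neg_mul (hA p)).const_mul _
  have hnorm : ∀ p, ∫ t in Ioi (0 : ℝ), ‖F p t‖ = (2 * (p.2 : ℝ) + 1) / A p ^ 2 := fun p => by
    rw [← mul_one_div, ← integral_mul_exp_neg_mul (hA p), ← integral_const_mul]
    refine setIntegral_congr_fun measurableSet_Ioi fun t ht => ?_
    have ht : 0 < t := ht
    simp only [F]
    rw [norm_mul, norm_mul, norm_zpow, norm_neg, norm_one, one_zpow, one_mul,
      Real.norm_of_nonneg (by positivity), Real.norm_of_nonneg (by positivity)]
  have h := hasSum_integral_of_summable_integral_norm hF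
    ((summable_two_mul_add_one_div hx).congr fun p => (hnorm p).symm)
  have hterm : ∀ p, ∫ t in Ioi (0 : ℝ), F p t =
      (-1 : ℝ) ^ (p.1 + (p.2 : ℤ)) * (2 * (p.2 : ℝ) + 1) / A p ^ 2 := fun p => by
    simp only [F]
    rw [integral_const_mul, integral_mul_exp_neg_mul (hA p), mul_one_div]
  have hval : ∫ t in Ioi (0 : ℝ), t * ((∑' n, etaTerm t n) ^ 3 * ∑' n, etaTerm (x * t) n) =
      ∫ t in Ioi (0 : ℝ), ∑' p, F p t := by
    refine setIntegral_congr_fun measurableSet_Ioi fun t ht => ?_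
    have ht : 0 < t := ht
    rw [tsum_etaTerm_cube ht, mul_comm (∑' k : ℕ, _),
      tsum_mul_tsum_of_summable_norm (summable_etaTerm (mul_pos hx ht)).norm
        (summable_two_mul_add_one_mul_exp ht).norm, ← tsum_mul_left]
    refine tsum_congr fun p => ?_
    have e : exp (-(A p * t)) = exp (-((6 * (p.1 : ℝ) + 1) ^ 2 * (x * t))) *
        exp (-(3 * (2 * (p.2 : ℝ) + 1) ^ 2 * t)) := by
      rw [← Real.exp_add]
      congr 1
      simp only [A]
      ring
    simp only [F, etaTerm]
    rw [e, zpow_add₀ (by norm_num), zpow_natCast]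
    ring
  rw [hval]
  simpa only [hterm] using h

end Integral

/-- For `x > 0`, the box limit defining `F(1,1,1,x)` exists and
`F(1,1,1,x)/(3+x)²` equals an absolutely convergent two-dimensional sum.
(Note `F(1,1,1,x)/(3+x)²` is exactly the limit of the box sums.) -/
theorem stmt_1 (x : ℝ) (hx : 0 < x) :
    Summable (fun p : ℤ × ℕ =>
      (-1:ℝ)^(p.1 + (p.2:ℤ)) * (2*(p.2:ℝ)+1) /
        (3*(2*(p.2:ℝ)+1)^2 + x*(6*(p.1:ℝ)+1)^2)^2) ∧
    Tendsto (fun v => boxSum 1 1 1 x v) atTop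
      (𝓝 (∑' p : ℤ × ℕ,
        (-1:ℝ)^(p.1 + (p.2:ℤ)) * (2*(p.2:ℝ)+1) /
          (3*(2*(p.2:ℝ)+1)^2 + x*(6*(p.1:ℝ)+1)^2)^2)) := by
  have h := hasSum_integral_etaTerm hx
  refine ⟨h.summable, ?_⟩
  rw [h.tsum_eq]
  exact tendsto_boxSum hx
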